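/- arXiv:1612.05537 — 4 statements merged into one kernel-verified Lean document; each statement's English description precedes it below -/
import Mathlib

section
/- Let A be an m×n real matrix, b ∈ ℝ^m, X ⊆ ℝ^n a nonempty compact set, and D(q) = max_{f∈X} ⟨q, b − A f⟩. Let q̂ ∈ ℝ^m with q̂ᵢ ≥ 0 for all i, let f* ∈ X attain D(q̂) (i.e. ⟨q̂, b − A f*⟩ = D(q̂)), set g = b − A f*, and let ĝ ∈ ℝ^m satisfy ĝᵢ ≥ gᵢ for all i. Define the updated vector q̂′ by q̂′ᵢ = max(q̂ᵢ − ĝᵢ, 0). Then ‖q̂′‖² ≤ ‖q̂‖² − 2 D(q̂) + ‖g‖², where ‖·‖ is the Euclidean norm on ℝ^m. -/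
/-- One-step descent inequality: if `q̂ ≥ 0`, `f* ∈ X` attains `D(q̂)`, `g = b − A f*`,
`ĝ ≥ g` componentwise, and `q̂′ = [q̂ − ĝ]⁺`, then `‖q̂′‖² ≤ ‖q̂‖² − 2 D(q̂) + ‖g‖²`. -/
theorem one_step_descent {m n : ℕ} (A : Matrix (Fin m) (Fin n) ℝ)
    (b : EuclideanSpace ℝ (Fin m)) (X : Set (EuclideanSpace ℝ (Fin n)))
    (hXne : X.Nonempty) (hXcompact : IsCompact X)
    (D : EuclideanSpace ℝ (Fin m) → ℝ)
    (hD : ∀ q : EuclideanSpace ℝ (Fin m),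
      IsGreatest {y : ℝ | ∃ f ∈ X, y = ∑ i, q i * (b i - A.mulVec f i)} (D q))
    (qhat : EuclideanSpace ℝ (Fin m)) (hqhat : ∀ i, 0 ≤ qhat i)
    (fstar : EuclideanSpace ℝ (Fin n)) (hfstar : fstar ∈ X)
    (hattain : ∑ i, qhat i * (b i - A.mulVec fstar i) = D qhat)
    (g : EuclideanSpace ℝ (Fin m)) (hg : ∀ i, g i = b i - A.mulVec fstar i)
    (ghat : EuclideanSpace ℝ (Fin m)) (hdom : ∀ i, g i ≤ ghat i)
    (qhat' : EuclideanSpace ℝ (Fin m)) (hupd : ∀ i, qhat' i = max (qhat i - ghat i) 0) :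
    ‖qhat'‖ ^ 2 ≤ ‖qhat‖ ^ 2 - 2 * D qhat + ‖g‖ ^ 2 := by
  have h_coord : ∀ i, qhat' i ^ 2 ≤ qhat i ^ 2 - 2 * (qhat i * g i) + g i ^ 2 := by
    intro i
    rw [hupd i]
    rcases max_cases (qhat i - ghat i) 0 with ⟨h, h0⟩ | ⟨h, -⟩ <;> rw [h]
    · nlinarith [hdom i]
    · nlinarith [sq_nonneg (qhat i - g i)]
  have h_dual : D qhat = ∑ i, qhat i * g i := by
    rw [← hattain]
    exact Finset.sum_congr rfl fun i _ => by rw [hg i]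
  rw [EuclideanSpace.real_norm_sq_eq, EuclideanSpace.real_norm_sq_eq,
    EuclideanSpace.real_norm_sq_eq, h_dual, Finset.mul_sum, ← Finset.sum_sub_distrib,
    ← Finset.sum_add_distrib]
  exact Finset.sum_le_sum fun i _ => h_coord i
end

section
/- Let A be an m×n real matrix, b ∈ ℝ^m, X ⊆ ℝ^n a nonempty compact set, D(q) = max_{f∈X} ⟨q, b − A f⟩, and G > 0. Let q̂ : ℕ → ℝ^m be a sequence with q̂(0) componentwise nonnegative such that for each t there exist f_t ∈ X attaining D(q̂(t)), g_t = b − A f_t with ‖g_t‖ ≤ G, and ĝ_t ∈ ℝ^m with (ĝ_t)ᵢ ≥ (g_t)ᵢ for all i, and q̂(t+1)ᵢ = max(q̂(t)ᵢ − (ĝ_t)ᵢ, 0). Then for every t with D(q̂(t)) > G²/2 one has ‖q̂(t+1)‖ < ‖q̂(t)‖; that is, outside the set S = {q : D(q) ≤ G²/2} the queue-length iterates strictly decrease in Euclidean norm (strictly approach the dual optimum q* = 0). -/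
/-- If `ghat` dominates `g` componentwise, the positive part of `q - ghat` is no longer than
`q - g`. -/
theorem norm_le_norm_sub_of_eq_max {ι : Type*} [Fintype ι] {p q g ghat : EuclideanSpace ℝ ι}
    (hdom : ∀ i, g i ≤ ghat i) (hp : ∀ i, p i = max (q i - ghat i) 0) : ‖p‖ ≤ ‖q - g‖ := by
  rw [EuclideanSpace.norm_eq, EuclideanSpace.norm_eq]
  refine Real.sqrt_le_sqrt (Finset.sum_le_sum fun i _ => ?_)
  rw [Real.norm_eq_abs, Real.norm_eq_abs, sq_le_sq, abs_abs, abs_abs, hp i,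
    abs_of_nonneg (le_max_right _ _), PiLp.sub_apply]
  exact max_le ((sub_le_sub_left (hdom i) _).trans (le_abs_self _)) (abs_nonneg _)

/-- A unit subgradient step shortens `q` when `‖g‖ ^ 2 < 2 ⟪q, g⟫`. -/
theorem norm_sub_lt_norm_of_sq_lt {E : Type*} [NormedAddCommGroup E] [InnerProductSpace ℝ E]
    {q g : E} (h : ‖g‖ ^ 2 < 2 * inner ℝ q g) : ‖q - g‖ < ‖q‖ := by
  refine lt_of_pow_lt_pow_left₀ 2 (norm_nonneg _) ?_
  rw [norm_sub_sq_real]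
  linarith

/-- Theorem 2: with the queue-length iteration `q̂(t+1) = [q̂(t) − ĝ_t]⁺`, where `ĝ_t`
dominates componentwise the exact subgradient `g_t = b − A f_t` (with `f_t ∈ X` attaining
`D(q̂(t))` and `‖g_t‖ ≤ G`), whenever `D(q̂(t)) > G²/2` the Euclidean norm of the iterate
strictly decreases: `‖q̂(t+1)‖ < ‖q̂(t)‖`. -/
theorem queue_lengths_strictly_decrease {m n : ℕ} (A : Matrix (Fin m) (Fin n) ℝ)
    (b : EuclideanSpace ℝ (Fin m)) (X : Set (EuclideanSpace ℝ (Fin n)))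
    (hXne : X.Nonempty) (hXcompact : IsCompact X)
    (D : EuclideanSpace ℝ (Fin m) → ℝ)
    (hD : ∀ q : EuclideanSpace ℝ (Fin m),
      IsGreatest {y : ℝ | ∃ f ∈ X, y = ∑ i, q i * (b i - A.mulVec f i)} (D q))
    (G : ℝ) (hG : 0 < G)
    (qhat : ℕ → EuclideanSpace ℝ (Fin m)) (hq0 : ∀ i, 0 ≤ qhat 0 i)
    (f : ℕ → EuclideanSpace ℝ (Fin n)) (hf : ∀ t, f t ∈ X)
    (hattain : ∀ t, ∑ i, qhat t i * (b i - A.mulVec (f t) i) = D (qhat t))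
    (g : ℕ → EuclideanSpace ℝ (Fin m)) (hg : ∀ t i, g t i = b i - A.mulVec (f t) i)
    (hGbound : ∀ t, ‖g t‖ ≤ G)
    (ghat : ℕ → EuclideanSpace ℝ (Fin m)) (hdom : ∀ t i, g t i ≤ ghat t i)
    (hupd : ∀ t i, qhat (t + 1) i = max (qhat t i - ghat t i) 0) :
    ∀ t, D (qhat t) > G ^ 2 / 2 → ‖qhat (t + 1)‖ < ‖qhat t‖ := by
  intro t ht
  have hinner : inner ℝ (qhat t) (g t) = D (qhat t) := by
    rw [← hattain t, PiLp.inner_apply]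
    refine Finset.sum_congr rfl fun i _ => ?_
    rw [← hg t i]
    simp [mul_comm]
  have hsq : ‖g t‖ ^ 2 ≤ G ^ 2 := pow_le_pow_left₀ (norm_nonneg _) (hGbound t) 2
  refine (norm_le_norm_sub_of_eq_max (hdom t) (hupd t)).trans_lt (norm_sub_lt_norm_of_sq_lt ?_)
  rw [hinner]
  linarith
end

section
/- Let A be an m×n real matrix, b ∈ ℝ^m, X ⊆ ℝ^n a nonempty compact set, D(q) = max_{f∈X} ⟨q, b − A f⟩, and G > 0. Let q̂ : ℕ → ℝ^m be a sequence with q̂(0) componentwise nonnegative such that for each t there exist f_t ∈ X attaining D(q̂(t)), g_t = b − A f_t with ‖g_t‖ ≤ G, and ĝ_t ∈ ℝ^m with (ĝ_t)ᵢ ≥ (g_t)ᵢ for all i, and q̂(t+1)ᵢ = max(q̂(t)ᵢ − (ĝ_t)ᵢ, 0). Then for every N ≥ 1, min_{0 ≤ t < N} D(q̂(t)) ≤ G²/2 + ‖q̂(0)‖²/(2N). -/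
/-- One step of a projected approximate subgradient iteration: if `h` dominates `g` and
`p = [q - h]⁺`, then `‖p‖ ≤ ‖q - g‖`. -/
theorem norm_le_norm_sub_of_eq_max_sub {ι : Type*} [Fintype ι] {p q g h : EuclideanSpace ℝ ι}
    (hdom : ∀ i, g i ≤ h i) (hp : ∀ i, p i = max (q i - h i) 0) : ‖p‖ ≤ ‖q - g‖ := by
  rw [← sq_le_sq₀ (norm_nonneg _) (norm_nonneg _), EuclideanSpace.real_norm_sq_eq,
    EuclideanSpace.real_norm_sq_eq]
  refine Finset.sum_le_sum fun i _ => sq_le_sq.2 ?_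
  rw [hp, abs_of_nonneg (le_max_right _ _), PiLp.sub_apply]
  exact max_le ((sub_le_sub_left (hdom i) _).trans (le_abs_self _)) (abs_nonneg _)

/-- If a nonnegative quantity `u` satisfies `u (t + 1) ≤ u t - 2 * d t + c`, then among the first
`N` terms of `d` at least one is at most `c / 2 + u 0 / (2 * N)`. -/
theorem exists_lt_le_of_forall_succ_le {u d : ℕ → ℝ} {c : ℝ} (hu : ∀ t, 0 ≤ u t)
    (hstep : ∀ t, u (t + 1) ≤ u t - 2 * d t + c) {N : ℕ} (hN : 1 ≤ N) :
    ∃ t < N, d t ≤ c / 2 + u 0 / (2 * N) := by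
  have hN' : (0 : ℝ) < N := by exact_mod_cast hN
  have htel : ∑ t ∈ Finset.range N, (u (t + 1) - u t) = u N - u 0 := Finset.sum_range_sub u N
  have hsum : ∑ t ∈ Finset.range N, d t ≤
      ∑ _t ∈ Finset.range N, (c / 2 + u 0 / (2 * N)) := by
    calc ∑ t ∈ Finset.range N, d t
        ≤ ∑ t ∈ Finset.range N, (c / 2 - (u (t + 1) - u t) / 2) :=
          Finset.sum_le_sum fun t _ => by linarith [hstep t]
      _ = N * (c / 2) - (u N - u 0) / 2 := by
          rw [Finset.sum_sub_distrib, ← Finset.sum_div _ (fun t => u (t + 1) - u t), htel]; simp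
      _ ≤ N * (c / 2) + u 0 / 2 := by linarith [hu N]
      _ = ∑ _t ∈ Finset.range N, (c / 2 + u 0 / (2 * N)) := by
          rw [Finset.sum_const, Finset.card_range, nsmul_eq_mul]; field_simp
  obtain ⟨t, ht, hle⟩ :=
    Finset.exists_le_of_sum_le (Finset.nonempty_range_iff.2 (by lia)) hsum
  exact ⟨t, Finset.mem_range.1 ht, hle⟩

/-- Finite-horizon form of Theorem 2: under the queue-length iteration
`q̂(t+1) = [q̂(t) − ĝ_t]⁺` with approximate subgradients dominating the exact ones,
for every `N ≥ 1` one has `min_{0 ≤ t < N} D(q̂(t)) ≤ G²/2 + ‖q̂(0)‖²/(2N)`. -/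
theorem min_dual_value_bound {m n : ℕ} (A : Matrix (Fin m) (Fin n) ℝ)
    (b : EuclideanSpace ℝ (Fin m)) (X : Set (EuclideanSpace ℝ (Fin n)))
    (hXne : X.Nonempty) (hXcompact : IsCompact X)
    (D : EuclideanSpace ℝ (Fin m) → ℝ)
    (hD : ∀ q : EuclideanSpace ℝ (Fin m),
      IsGreatest {y : ℝ | ∃ f ∈ X, y = ∑ i, q i * (b i - A.mulVec f i)} (D q))
    (G : ℝ) (hG : 0 < G)
    (qhat : ℕ → EuclideanSpace ℝ (Fin m)) (hq0 : ∀ i, 0 ≤ qhat 0 i)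
    (f : ℕ → EuclideanSpace ℝ (Fin n)) (hf : ∀ t, f t ∈ X)
    (hattain : ∀ t, ∑ i, qhat t i * (b i - A.mulVec (f t) i) = D (qhat t))
    (g : ℕ → EuclideanSpace ℝ (Fin m)) (hg : ∀ t i, g t i = b i - A.mulVec (f t) i)
    (hGbound : ∀ t, ‖g t‖ ≤ G)
    (ghat : ℕ → EuclideanSpace ℝ (Fin m)) (hdom : ∀ t i, g t i ≤ ghat t i)
    (hupd : ∀ t i, qhat (t + 1) i = max (qhat t i - ghat t i) 0) :
    ∀ N : ℕ, 1 ≤ N →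
      ∃ t < N, D (qhat t) ≤ G ^ 2 / 2 + ‖qhat 0‖ ^ 2 / (2 * N) := by
  intro N hN
  refine exists_lt_le_of_forall_succ_le (u := fun t => ‖qhat t‖ ^ 2) (d := fun t => D (qhat t))
    (fun t => sq_nonneg _) (fun t => ?_) hN
  have hinner : inner ℝ (qhat t) (g t) = D (qhat t) := by
    rw [← hattain t, PiLp.inner_apply]
    exact Finset.sum_congr rfl fun i _ => by rw [hg]; simp [mul_comm]
  calc ‖qhat (t + 1)‖ ^ 2 ≤ ‖qhat t - g t‖ ^ 2 := by
        gcongr; exact norm_le_norm_sub_of_eq_max_sub (hdom t) (hupd t)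
    _ = ‖qhat t‖ ^ 2 - 2 * D (qhat t) + ‖g t‖ ^ 2 := by rw [norm_sub_sq_real, hinner]
    _ ≤ ‖qhat t‖ ^ 2 - 2 * D (qhat t) + G ^ 2 := by gcongr; exact hGbound t
end

section
/- Let A be an m×n real matrix, b ∈ ℝ^m, X ⊆ ℝ^n a nonempty compact set, D(q) = max_{f∈X} ⟨q, b − A f⟩, and G > 0. Let q̂ : ℕ → ℝ^m be a sequence with q̂(0) componentwise nonnegative such that for each t there exist f_t ∈ X attaining D(q̂(t)), g_t = b − A f_t with ‖g_t‖ ≤ G, and ĝ_t ∈ ℝ^m with (ĝ_t)ᵢ ≥ (g_t)ᵢ for all i, and q̂(t+1)ᵢ = max(q̂(t)ᵢ − (ĝ_t)ᵢ, 0). Then liminf_{t→∞} D(q̂(t)) ≤ G²/2; in particular, for every δ > 0 the set of times t with q̂(t) ∈ {q : D(q) ≤ G²/2 + δ} is infinite. -/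
/-- A nonnegative real sequence cannot satisfy `V (t + 1) ≤ V t - 2 * d t + c` with `d t`
eventually at least `c / 2 + δ`, `δ > 0`. -/
theorem frequently_lt_of_drift {V d : ℕ → ℝ} {c δ : ℝ} (hV : ∀ t, 0 ≤ V t)
    (hstep : ∀ t, V (t + 1) ≤ V t - 2 * d t + c) (hδ : 0 < δ) :
    ∃ᶠ t in Filter.atTop, d t < c / 2 + δ := by
  intro hev
  obtain ⟨N, hN⟩ := Filter.eventually_atTop.1 hev
  have hdec : ∀ k : ℕ, V (N + k) ≤ V N - k * (2 * δ) := by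
    intro k
    induction k with
    | zero => simp
    | succ k ih =>
      have h1 := hstep (N + k)
      have h2 := not_lt.1 (hN (N + k) (Nat.le_add_right N k))
      rw [← add_assoc]
      push_cast
      linarith
  obtain ⟨k, hk⟩ := exists_nat_gt (V N / (2 * δ))
  rw [div_lt_iff₀ (by positivity)] at hk
  linarith [hdec k, hV (N + k)]

/-- One projected step along a componentwise upper bound `h` of `g` decreases the squared norm
at least as much as the plain step along `g`. -/
theorem norm_sq_projected_step_le {ι : Type*} [Fintype ι] {q q' g h : EuclideanSpace ℝ ι}
    (hgh : ∀ i, g i ≤ h i) (hq' : ∀ i, q' i = max (q i - h i) 0) :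
    ‖q'‖ ^ 2 ≤ ‖q‖ ^ 2 - 2 * ∑ i, q i * g i + ‖g‖ ^ 2 := by
  simp only [EuclideanSpace.real_norm_sq_eq, Finset.mul_sum, ← Finset.sum_sub_distrib,
    ← Finset.sum_add_distrib]
  refine Finset.sum_le_sum fun i _ => ?_
  rw [hq' i]
  rcases le_total (q i - h i) 0 with hi | hi
  · rw [max_eq_right hi]
    nlinarith [sq_nonneg (q i - g i)]
  · rw [max_eq_left hi]
    nlinarith [hgh i]


/-- Asymptotic form of Theorem 2: under the queue-length iteration
`q̂(t+1) = [q̂(t) − ĝ_t]⁺` with approximate subgradients dominating the exact ones,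
`liminf_{t→∞} D(q̂(t)) ≤ G²/2`; in particular, for every `δ > 0` the set of times `t`
with `q̂(t) ∈ {q : D(q) ≤ G²/2 + δ}` is infinite. -/
theorem liminf_dual_value_bound {m n : ℕ} (A : Matrix (Fin m) (Fin n) ℝ)
    (b : EuclideanSpace ℝ (Fin m)) (X : Set (EuclideanSpace ℝ (Fin n)))
    (hXne : X.Nonempty) (hXcompact : IsCompact X)
    (D : EuclideanSpace ℝ (Fin m) → ℝ)
    (hD : ∀ q : EuclideanSpace ℝ (Fin m),
      IsGreatest {y : ℝ | ∃ f ∈ X, y = ∑ i, q i * (b i - A.mulVec f i)} (D q))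
    (G : ℝ) (hG : 0 < G)
    (qhat : ℕ → EuclideanSpace ℝ (Fin m)) (hq0 : ∀ i, 0 ≤ qhat 0 i)
    (f : ℕ → EuclideanSpace ℝ (Fin n)) (hf : ∀ t, f t ∈ X)
    (hattain : ∀ t, ∑ i, qhat t i * (b i - A.mulVec (f t) i) = D (qhat t))
    (g : ℕ → EuclideanSpace ℝ (Fin m)) (hg : ∀ t i, g t i = b i - A.mulVec (f t) i)
    (hGbound : ∀ t, ‖g t‖ ≤ G)
    (ghat : ℕ → EuclideanSpace ℝ (Fin m)) (hdom : ∀ t i, g t i ≤ ghat t i)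
    (hupd : ∀ t i, qhat (t + 1) i = max (qhat t i - ghat t i) 0) :
    Filter.liminf (fun t => D (qhat t)) Filter.atTop ≤ G ^ 2 / 2 ∧
      ∀ δ > (0 : ℝ), {t : ℕ | qhat t ∈ {q | D q ≤ G ^ 2 / 2 + δ}}.Infinite := by
  have hstep : ∀ t, ‖qhat (t + 1)‖ ^ 2 ≤ ‖qhat t‖ ^ 2 - 2 * D (qhat t) + G ^ 2 := by
    intro t
    have h1 := norm_sq_projected_step_le (hdom t) (hupd t)
    simp only [hg, hattain] at h1
    have h2 : ‖g t‖ ^ 2 ≤ G ^ 2 := pow_le_pow_left₀ (norm_nonneg _) (hGbound t) 2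
    linarith
  have hfreq : ∀ δ > (0 : ℝ), ∃ᶠ t in Filter.atTop, D (qhat t) < G ^ 2 / 2 + δ :=
    fun δ hδ => frequently_lt_of_drift (fun t => sq_nonneg ‖qhat t‖) hstep hδ
  refine ⟨?_, fun δ hδ => Nat.frequently_atTop_iff_infinite.1 ((hfreq δ hδ).mono fun t ht => ht.le)⟩
  rw [Filter.liminf_eq]
  refine Real.sSup_le (fun a ha => le_of_forall_pos_le_add fun δ hδ => ?_) (by positivity)
  obtain ⟨t, ht, hat⟩ := ((hfreq δ hδ).and_eventually ha).exists
  exact hat.trans ht.le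
end
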